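/- arXiv:2510.16827 — 7 statements merged into one kernel-verified Lean document; each statement's English description precedes it below -/
import Mathlib

section
/- Assume f and c_i for i ∈ I are convex functions, c_i for i ∈ E are affine, and Slater's condition holds: there exist a subset J ⊆ I such that c_j is affine for every j ∈ J, and a point x̄ ∈ ℝ^n with c_i(x̄) = 0 for all i ∈ E, c_j(x̄) ≤ 0 for all j ∈ J, and c_k(x̄) < 0 for all k ∈ I ∖ J. Then for every ρ > 0 strong duality holds for the augmented Lagrangian saddle-point problem: sup_{λ∈ℝ^E, μ∈ℝ^I} inf_{x∈ℝ^n} 𝕃_ρ(x,λ,μ) = inf_{x∈ℝ^n} sup_{λ∈ℝ^E, μ∈ℝ^I} 𝕃_ρ(x,λ,μ), in the extended reals. -/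
open scoped BigOperators

/-- The Hestenes–Powell–Rockafellar augmented Lagrangian for the nonlinear program
`min f(x) s.t. cE i x = 0 (i ∈ E), cI i x ≤ 0 (i ∈ I)`. -/
noncomputable def AL {n : ℕ} {E I : Type*} [Fintype E] [Fintype I]
    (f : (Fin n → ℝ) → ℝ) (cE : E → (Fin n → ℝ) → ℝ) (cI : I → (Fin n → ℝ) → ℝ)
    (ρ : ℝ) (x : Fin n → ℝ) (lam : E → ℝ) (μ : I → ℝ) : ℝ :=
  f x + ∑ i, lam i * cE i x + (ρ / 2) * ∑ i, (cE i x) ^ 2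
    + (ρ / 2) * ∑ i, ((max (μ i / ρ + cI i x) 0) ^ 2 - (μ i) ^ 2 / ρ ^ 2)

/-- **Farkas' lemma**: a linear form that is nonpositive on a polyhedral cone is a nonnegative
combination of the linear forms defining the cone. -/
theorem exists_nonneg_sum_smul_eq_of_forall_le {V ι : Type*} [AddCommGroup V] [Module ℝ V]
    (s : Finset ι) (a : ι → V →ₗ[ℝ] ℝ) (g : V →ₗ[ℝ] ℝ)
    (h : ∀ x, (∀ i ∈ s, a i x ≤ 0) → g x ≤ 0) :
    ∃ μ : ι → ℝ, (∀ i, 0 ≤ μ i) ∧ g = ∑ i ∈ s, μ i • a i := by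
  classical
  induction s using Finset.induction_on generalizing a g with
  | empty =>
    refine ⟨0, fun _ => le_rfl, LinearMap.ext fun x => ?_⟩
    have h₁ := h x (by simp)
    have h₂ := h (-x) (by simp)
    rw [map_neg] at h₂
    simpa using le_antisymm h₁ (by linarith)
  | insert j s hj ih =>
    by_cases hs : ∀ x, (∀ i ∈ s, a i x ≤ 0) → g x ≤ 0
    · obtain ⟨μ, hμ, rfl⟩ := ih a g hs
      refine ⟨fun i => if i = j then 0 else μ i, fun i => by dsimp only; split_ifs <;> simp [hμ],
        ?_⟩
      rw [Finset.sum_insert hj]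
      simp only [if_true, zero_smul, zero_add]
      refine Finset.sum_congr rfl fun i hi => ?_
      rw [if_neg (ne_of_mem_of_not_mem hi hj)]
    · push Not at hs
      obtain ⟨y, hy, hgy⟩ := hs
      have hjy : 0 < a j y := by
        by_contra! hle
        exact absurd (h y (by simpa [Finset.forall_mem_insert] using ⟨hle, hy⟩)) (not_le.2 hgy)
      obtain ⟨μ, hμ, hg⟩ := ih (fun i => a i - (a i y / a j y) • a j) (g - (g y / a j y) • a j) (by
        intro x hx
        have key := h (x - (a j x / a j y) • y) (by
          intro i hi
          rcases Finset.mem_insert.1 hi with rfl | hi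
          · simp [hjy.ne']
          · have := hx i hi
            simp only [LinearMap.sub_apply, LinearMap.smul_apply, smul_eq_mul] at this
            simp only [map_sub, map_smul, smul_eq_mul]
            linarith [div_mul_comm (a i y) (a j y) (a j x)])
        simp only [map_sub, map_smul, smul_eq_mul] at key
        simp only [LinearMap.sub_apply, LinearMap.smul_apply, smul_eq_mul]
        linarith [div_mul_comm (g y) (a j y) (a j x)])
      set t : ℝ := g y / a j y - ∑ i ∈ s, μ i * (a i y / a j y) with ht
      have ht0 : 0 ≤ t := by
        have h₁ : ∑ i ∈ s, μ i * (a i y / a j y) ≤ 0 := Finset.sum_nonpos fun i hi =>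
          mul_nonpos_of_nonneg_of_nonpos (hμ i) (div_nonpos_of_nonpos_of_nonneg (hy i hi) hjy.le)
        have h₂ : 0 ≤ g y / a j y := by positivity
        linarith
      refine ⟨fun i => if i = j then t else μ i, fun i => ?_, ?_⟩
      · dsimp only
        split_ifs
        exacts [ht0, hμ i]
      · rw [Finset.sum_insert hj]
        have hsum : ∑ i ∈ s, (if i = j then t else μ i) • a i = ∑ i ∈ s, μ i • a i :=
          Finset.sum_congr rfl fun i hi => by rw [if_neg (ne_of_mem_of_not_mem hi hj)]
        dsimp only
        rw [hsum, if_pos rfl]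
        refine LinearMap.ext fun x => ?_
        have hgx := LinearMap.congr_fun hg x
        simp only [LinearMap.sub_apply, LinearMap.smul_apply, smul_eq_mul, LinearMap.sum_apply,
          mul_sub, Finset.sum_sub_distrib, ← mul_assoc, ← Finset.sum_mul] at hgx
        simp only [LinearMap.add_apply, LinearMap.smul_apply, smul_eq_mul, LinearMap.sum_apply, ht,
          sub_mul]
        linarith

/-- **Affine Farkas' lemma**: an affine function that is nonnegative on a nonempty polyhedron has
nonnegative Lagrange multipliers. -/
theorem exists_nonneg_forall_nonneg_add_sum_of_affine {V ι : Type*} [AddCommGroup V] [Module ℝ V]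
    [Fintype ι] (a : ι → V →ₗ[ℝ] ℝ) (b : ι → ℝ) (g : V →ₗ[ℝ] ℝ) (c : ℝ)
    (hne : ∃ x, ∀ i, a i x + b i ≤ 0)
    (h : ∀ x, (∀ i, a i x + b i ≤ 0) → 0 ≤ g x + c) :
    ∃ μ : ι → ℝ, (∀ i, 0 ≤ μ i) ∧ ∀ x, 0 ≤ g x + c + ∑ i, μ i * (a i x + b i) := by
  obtain ⟨x₀, hx₀⟩ := hne
  let A : Option ι → V × ℝ →ₗ[ℝ] ℝ := fun o =>
    o.elim (-LinearMap.snd ℝ V ℝ) fun i => (a i).coprod (b i • LinearMap.id)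
  let G : V × ℝ →ₗ[ℝ] ℝ := -(g.coprod (c • LinearMap.id))
  obtain ⟨μ, hμ, hG⟩ := exists_nonneg_sum_smul_eq_of_forall_le Finset.univ A G (by
    rintro ⟨x, t⟩ hx
    have ht : 0 ≤ t := by simpa [A] using hx none (Finset.mem_univ _)
    have hi : ∀ i, a i x + b i * t ≤ 0 := fun i => by
      simpa [A] using hx (some i) (Finset.mem_univ _)
    suffices 0 ≤ g x + c * t by simpa [G, add_comm] using neg_nonpos.2 this
    rcases ht.eq_or_lt with rfl | ht
    · by_contra! hlt
      simp only [mul_zero, add_zero] at hlt hi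
      have hray : ∀ r : ℝ, 0 ≤ r → 0 ≤ g x₀ + c + r * g x := fun r hr => by
        have := h (x₀ + r • x) fun i => by
          simp only [map_add, map_smul, smul_eq_mul]
          nlinarith [hx₀ i, mul_nonneg hr (neg_nonneg.2 (hi i))]
        simp only [map_add, map_smul, smul_eq_mul] at this
        linarith
      have h₀ := hray 0 le_rfl
      have h₁ := hray ((g x₀ + c + 1) / -g x) (div_nonneg (by linarith) (by linarith))
      have h₂ : (g x₀ + c + 1) / -g x * g x = -(g x₀ + c + 1) := by
        rw [div_neg, neg_mul, div_mul_cancel₀ _ hlt.ne]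
      linarith
    · have := h (t⁻¹ • x) fun i => by
        have h₁ := mul_nonpos_of_nonneg_of_nonpos (inv_nonneg.2 ht.le) (hi i)
        have h₂ : t⁻¹ * (a i x + b i * t) = t⁻¹ * a i x + b i := by field_simp
        simpa [h₂] using h₁
      have h₂ : t * (g (t⁻¹ • x) + c) = g x + c * t := by
        simp only [map_smul, smul_eq_mul]
        field_simp
      rw [← h₂]
      exact mul_nonneg ht.le this)
  refine ⟨fun i => μ (some i), fun i => hμ _, fun x => ?_⟩
  have := LinearMap.congr_fun hG (x, 1)
  simp [A, G, Fintype.sum_option] at this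
  have h₀ := hμ none
  linarith

/-- A convex function bounded below by `p` on a nonempty polyhedron has nonnegative Lagrange
multipliers. -/
theorem ConvexOn.exists_nonneg_forall_le_add_sum_of_affine {V ι : Type*} [NormedAddCommGroup V]
    [NormedSpace ℝ V] [FiniteDimensional ℝ V] [Fintype ι] {f : V → ℝ}
    (hf : ConvexOn ℝ Set.univ f) (a : ι → V →ₗ[ℝ] ℝ) (b : ι → ℝ) (p : ℝ)
    (hne : ∃ x, ∀ i, a i x + b i ≤ 0) (h : ∀ x, (∀ i, a i x + b i ≤ 0) → p ≤ f x) :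
    ∃ μ : ι → ℝ, (∀ i, 0 ≤ μ i) ∧ ∀ x, p ≤ f x + ∑ i, μ i * (a i x + b i) := by
  have hfc : Continuous f := continuousOn_univ.1 (hf.continuousOn isOpen_univ)
  have hK : Convex ℝ {x : V | ∀ i, a i x + b i ≤ 0} := by
    intro x hx y hy s t hs ht hst i
    simp only [map_add, map_smul, smul_eq_mul]
    have h₁ := mul_nonpos_of_nonneg_of_nonpos hs (hx i)
    have h₂ := mul_nonpos_of_nonneg_of_nonpos ht (hy i)
    have h₃ : s * b i + t * b i = b i := by rw [← add_mul, hst, one_mul]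
    linarith
  obtain ⟨φ, u, hφ₁, hφ₂⟩ := geometric_hahn_banach_open
    (s := {z : V × ℝ | f z.1 < z.2}) (t := {x : V | ∀ i, a i x + b i ≤ 0} ×ˢ Set.Iic p)
    (by simpa using hf.convex_strict_epigraph)
    (isOpen_lt (hfc.comp continuous_fst) continuous_snd)
    (hK.prod (convex_Iic p))
    (Set.disjoint_left.2 fun z hz hz' => absurd (h z.1 hz'.1) (not_le.2 (hz.trans_le hz'.2)))
  set s : ℝ := φ (0, 1) with hs
  let l : V →ₗ[ℝ] ℝ := φ.toLinearMap ∘ₗ LinearMap.inl ℝ V ℝ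
  have hφ : ∀ x t, φ (x, t) = l x + t * s := fun x t => by
    have : (x, t) = (x, (0 : ℝ)) + t • ((0 : V), (1 : ℝ)) := by simp
    rw [this, map_add, map_smul]
    rfl
  have h₁ : ∀ x t, f x < t → l x + t * s < u := fun x t hxt => by
    rw [← hφ]; exact hφ₁ (x, t) hxt
  have h₂ : ∀ x, (∀ i, a i x + b i ≤ 0) → u ≤ l x + p * s := fun x hx => by
    rw [← hφ]; exact hφ₂ (x, p) ⟨hx, Set.self_mem_Iic⟩
  obtain ⟨x₀, hx₀⟩ := hne
  have hs0 : s < 0 := by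
    have := h₁ x₀ (f x₀ + 1) (by linarith)
    nlinarith [h₂ x₀ hx₀, h x₀ hx₀]
  have h₃ : ∀ x, l x + f x * s ≤ u := fun x => by
    refine le_of_forall_pos_lt_add fun ε hε => ?_
    have := h₁ x (f x + ε / -s) (by linarith [div_pos hε (neg_pos.2 hs0)])
    have h₄ : ε / -s * s = -ε := by
      rw [div_neg, neg_mul, div_mul_cancel₀ _ hs0.ne]
    rw [add_mul, h₄] at this
    linarith
  obtain ⟨μ, hμ, hμ'⟩ := exists_nonneg_forall_nonneg_add_sum_of_affine a b l (p * s - u)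
    ⟨x₀, hx₀⟩ fun x hx => by linarith [h₂ x hx]
  refine ⟨fun i => μ i / -s, fun i => div_nonneg (hμ i) (by linarith), fun x => ?_⟩
  have h₄ : ∑ i, μ i / -s * (a i x + b i) = (∑ i, μ i * (a i x + b i)) / -s := by
    rw [Finset.sum_div]
    exact Finset.sum_congr rfl fun i _ => by ring
  rw [h₄, ← sub_le_iff_le_add', le_div_iff₀ (by linarith)]
  linarith [h₃ x, hμ' x]

/-- Lagrange multipliers for strictly feasible convex inequality constraints on a convex set. -/
theorem ConvexOn.exists_nonneg_forall_mem_le_add_sum {V κ : Type*} [AddCommGroup V] [Module ℝ V]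
    [Fintype κ] {K : Set V} {f : V → ℝ} {c : κ → V → ℝ} (hf : ConvexOn ℝ K f)
    (hc : ∀ k, ConvexOn ℝ K (c k)) (p : ℝ) (hne : ∃ x ∈ K, ∀ k, c k x < 0)
    (h : ∀ x ∈ K, (∀ k, c k x ≤ 0) → p ≤ f x) :
    ∃ μ : κ → ℝ, (∀ k, 0 ≤ μ k) ∧ ∀ x ∈ K, p ≤ f x + ∑ k, μ k * c k x := by
  classical
  obtain ⟨x₀, hx₀K, hx₀⟩ := hne
  let S : Set (ℝ × (κ → ℝ)) := {z | ∃ x ∈ K, f x < z.1 ∧ ∀ k, c k x < z.2 k}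
  have hSc : Convex ℝ S := by
    rintro z ⟨x, hx, hfx, hcx⟩ w ⟨y, hy, hfy, hcy⟩ s t hs ht hst
    have comb : ∀ {q : V → ℝ} {A B : ℝ}, ConvexOn ℝ K q → q x < A → q y < B →
        q (s • x + t • y) < s * A + t * B := fun {q A B} hq hA hB => by
      refine (hq.2 hx hy hs ht hst).trans_lt ?_
      simp only [smul_eq_mul]
      rcases hs.eq_or_lt with rfl | hs
      · obtain rfl : t = 1 := by linarith
        linarith
      · nlinarith [mul_lt_mul_of_pos_left hA hs, mul_le_mul_of_nonneg_left hB.le ht]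
    exact ⟨s • x + t • y, hf.1 hx hy hs ht hst, comb hf hfx hfy,
      fun k => comb (hc k) (hcx k) (hcy k)⟩
  have hSo : IsOpen S := by
    have : S = ⋃ x ∈ K, {z : ℝ × (κ → ℝ) | f x < z.1} ∩ ⋂ k, {z | c k x < z.2 k} := by
      ext z
      simp [S, and_left_comm]
    rw [this]
    refine isOpen_biUnion fun x _ => (isOpen_lt continuous_const continuous_fst).inter
      (isOpen_iInter_of_finite fun k => isOpen_lt continuous_const (by fun_prop))
  obtain ⟨φ, hφ⟩ := geometric_hahn_banach_open_point (x := (p, 0)) hSc hSo (by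
    rintro ⟨x, hx, hfx, hcx⟩
    exact absurd (h x hx fun k => (hcx k).le) (not_le.2 hfx))
  set α : ℝ := φ (1, 0) with hα
  let β : κ → ℝ := fun k => φ (0, Pi.single k 1)
  have hform : ∀ r v, φ (r, v) = r * α + ∑ k, v k * β k := fun r v => by
    have : (r, v) = r • ((1 : ℝ), (0 : κ → ℝ)) +
        ∑ k, v k • ((0 : ℝ), (Pi.single k 1 : κ → ℝ)) := by
      refine Prod.ext (by simp [Prod.fst_sum]) ?_
      simp only [Prod.snd_add, Prod.smul_snd, Prod.snd_sum, smul_zero, zero_add]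
      ext j
      simp [Finset.sum_apply, Pi.single_apply]
    rw [this, map_add, map_smul, map_sum]
    simp only [map_smul, smul_eq_mul, α, β]
  have key : ∀ x ∈ K, ∀ (r : ℝ) (v : κ → ℝ), f x < r → (∀ k, c k x < v k) →
      r * α + ∑ k, v k * β k < p * α := fun x hx r v hr hv => by
    have := hφ (r, v) ⟨x, hx, hr, hv⟩
    rw [hform, hform] at this
    simpa using this
  have hkey₀ : ∀ x ∈ K, f x * α + ∑ k, c k x * β k ≤ p * α := fun x hx => by
    have hcont : Continuous fun ε : ℝ => (f x + ε) * α + ∑ k, (c k x + ε) * β k := by fun_prop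
    have hlim : Filter.Tendsto (fun ε : ℝ => (f x + ε) * α + ∑ k, (c k x + ε) * β k)
        (nhdsWithin 0 (Set.Ioi 0)) (nhds (f x * α + ∑ k, c k x * β k)) := by
      simpa using (hcont.tendsto 0).mono_left nhdsWithin_le_nhds
    refine le_of_tendsto hlim ?_
    filter_upwards [self_mem_nhdsWithin] with ε hε
    exact (key x hx _ _ (lt_add_of_pos_right _ hε) fun k => lt_add_of_pos_right _ hε).le
  have hβ : ∀ k, β k ≤ 0 := fun k => by
    by_contra! hk
    set q : ℝ := (f x₀ + 1) * α + ∑ j, (c j x₀ + 1) * β j with hq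
    have hM : 0 ≤ |p * α - q| / β k := by positivity
    have := key x₀ hx₀K (f x₀ + 1) (fun j => (c j x₀ + 1) + if j = k then |p * α - q| / β k else 0)
      (by linarith) fun j => by
        split_ifs <;> linarith
    simp only [add_mul (_ + _) (ite _ _ _), Finset.sum_add_distrib, ite_mul, zero_mul,
      Finset.sum_ite_eq', Finset.mem_univ, if_true, div_mul_cancel₀ _ hk.ne'] at this
    linarith [le_abs_self (p * α - q)]
  have hα0 : α < 0 := by
    by_contra! hα0
    have h₁ := key x₀ hx₀K (max (f x₀) p + 1) 0 (by linarith [le_max_left (f x₀) p])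
      (by simpa using hx₀)
    simp only [Pi.zero_apply, zero_mul, Finset.sum_const_zero, add_zero] at h₁
    nlinarith [le_max_right (f x₀) p]
  refine ⟨fun k => β k / α, fun k => div_nonneg_of_nonpos (hβ k) hα0.le, fun x hx => ?_⟩
  have h₁ : ∑ k, β k / α * c k x = (∑ k, c k x * β k) / α := by
    rw [Finset.sum_div]
    exact Finset.sum_congr rfl fun k _ => by ring
  have h₂ : (∑ k, c k x * β k) / α * α = ∑ k, c k x * β k := div_mul_cancel₀ _ hα0.ne
  rw [h₁]
  nlinarith [hkey₀ x hx]

theorem AL_le_of_feasible {n : ℕ} {E I : Type*} [Fintype E] [Fintype I]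
    (f : (Fin n → ℝ) → ℝ) (cE : E → (Fin n → ℝ) → ℝ) (cI : I → (Fin n → ℝ) → ℝ)
    {ρ : ℝ} (hρ : 0 < ρ) {x : Fin n → ℝ} (hE : ∀ i, cE i x = 0) (hI : ∀ i, cI i x ≤ 0)
    (lam : E → ℝ) (μ : I → ℝ) : AL f cE cI ρ x lam μ ≤ f x := by
  have h : ∑ i, ((max (μ i / ρ + cI i x) 0) ^ 2 - (μ i) ^ 2 / ρ ^ 2) ≤ 0 :=
    Finset.sum_nonpos fun i _ => by
      rw [← div_pow]
      rcases le_total (μ i / ρ + cI i x) 0 with h | h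
      · rw [max_eq_right h]; nlinarith [sq_nonneg (μ i / ρ)]
      · rw [max_eq_left h]; nlinarith [hI i]
  simp only [AL, hE]
  simp only [mul_zero, Finset.sum_const_zero, ne_eq, OfNat.ofNat_ne_zero, not_false_eq_true,
    zero_pow, add_zero]
  nlinarith

theorem lagrangian_le_AL {n : ℕ} {E I : Type*} [Fintype E] [Fintype I]
    (f : (Fin n → ℝ) → ℝ) (cE : E → (Fin n → ℝ) → ℝ) (cI : I → (Fin n → ℝ) → ℝ)
    {ρ : ℝ} (hρ : 0 < ρ) (x : Fin n → ℝ) (lam : E → ℝ) {μ : I → ℝ} (hμ : ∀ i, 0 ≤ μ i) :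
    f x + ∑ i, lam i * cE i x + ∑ i, μ i * cI i x ≤ AL f cE cI ρ x lam μ := by
  have h₁ : 0 ≤ (ρ / 2) * ∑ i, (cE i x) ^ 2 := by positivity
  have h₂ : ∑ i, μ i * cI i x ≤
      (ρ / 2) * ∑ i, ((max (μ i / ρ + cI i x) 0) ^ 2 - (μ i) ^ 2 / ρ ^ 2) := by
    rw [Finset.mul_sum]
    refine Finset.sum_le_sum fun i _ => ?_
    obtain ⟨t, ht⟩ : ∃ t, t = μ i / ρ := ⟨_, rfl⟩
    have hμt : μ i = ρ * t := by rw [ht]; field_simp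
    have ht0 : 0 ≤ t := ht ▸ div_nonneg (hμ i) hρ.le
    rw [← div_pow, ← ht, hμt]
    have : 2 * (t * cI i x) ≤ (max (t + cI i x) 0) ^ 2 - t ^ 2 := by
      rcases le_total (t + cI i x) 0 with h | h
      · rw [max_eq_right h]; nlinarith
      · rw [max_eq_left h]; nlinarith [sq_nonneg (cI i x)]
    nlinarith
  unfold AL
  linarith

/-- Existence of Lagrange multipliers for a convex program under Slater's condition. -/
theorem exists_lagrange_multipliers_of_slater {V E I : Type*} [NormedAddCommGroup V]
    [NormedSpace ℝ V] [FiniteDimensional ℝ V] [Fintype E] [Fintype I]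
    {f : V → ℝ} {cE : E → V → ℝ} {cI : I → V → ℝ}
    (hf : ConvexOn ℝ Set.univ f) (hcI : ∀ i, ConvexOn ℝ Set.univ (cI i))
    (hcE : ∀ i, ∃ (g : V →ₗ[ℝ] ℝ) (b : ℝ), ∀ x, cE i x = g x + b)
    {J : Set I} (hJ : ∀ j ∈ J, ∃ (g : V →ₗ[ℝ] ℝ) (b : ℝ), ∀ x, cI j x = g x + b)
    {xbar : V} (hxE : ∀ i, cE i xbar = 0) (hxJ : ∀ j ∈ J, cI j xbar ≤ 0)
    (hxI : ∀ k ∉ J, cI k xbar < 0) {p : ℝ}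
    (hp : ∀ x, (∀ i, cE i x = 0) → (∀ i, cI i x ≤ 0) → p ≤ f x) :
    ∃ (lam : E → ℝ) (μ : I → ℝ), (∀ i, 0 ≤ μ i) ∧
      ∀ x, p ≤ f x + ∑ i, lam i * cE i x + ∑ i, μ i * cI i x := by
  classical
  choose gE bE hgE using hcE
  choose gJ bJ hgJ using fun j : {j // j ∈ J} => hJ j j.2
  let a : E ⊕ E ⊕ {j // j ∈ J} → V →ₗ[ℝ] ℝ := Sum.elim gE (Sum.elim (fun i => -gE i) gJ)
  let b : E ⊕ E ⊕ {j // j ∈ J} → ℝ := Sum.elim bE (Sum.elim (fun i => -bE i) bJ)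
  let K : Set V := {x | (∀ i, cE i x = 0) ∧ ∀ j ∈ J, cI j x ≤ 0}
  have hab : ∀ x, (∀ i, a i x + b i ≤ 0) ↔ x ∈ K := fun x => by
    simp only [a, b, K, Sum.forall, Sum.elim_inl, Sum.elim_inr, Set.mem_ofPred_eq, ← hgE, ← hgJ,
      LinearMap.neg_apply, ← neg_add, Subtype.forall, neg_nonpos, ← and_assoc, ← forall_and,
      le_antisymm_iff]
  have hK : Convex ℝ K := by
    have : K = (⋂ i, {x | cE i x = 0}) ∩ ⋂ j : {j // j ∈ J}, {x | cI j x ≤ 0} := by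
      ext x
      simp [K]
    rw [this]
    refine (convex_iInter fun i => ?_).inter
      (convex_iInter fun j => by simpa using (hcI j).convex_le 0)
    intro x hx y hy s t _ _ hst
    have hx' : gE i x = -bE i := by have : cE i x = 0 := hx; rw [hgE] at this; linarith
    have hy' : gE i y = -bE i := by have : cE i y = 0 := hy; rw [hgE] at this; linarith
    simp only [Set.mem_ofPred_eq, hgE, map_add, map_smul, smul_eq_mul, hx', hy']
    linear_combination (-bE i) * hst
  obtain ⟨ν, hν, hν'⟩ := ConvexOn.exists_nonneg_forall_mem_le_add_sum
    (c := fun k : {k // k ∉ J} => cI k) (hf.subset (Set.subset_univ K) hK)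
    (fun k => (hcI k).subset (Set.subset_univ K) hK) p
    ⟨xbar, ⟨hxE, hxJ⟩, fun k => hxI k k.2⟩ fun x hx hk =>
      hp x hx.1 fun i => if hi : i ∈ J then hx.2 i hi else hk ⟨i, hi⟩
  have hconv : ConvexOn ℝ Set.univ fun x => f x + ∑ k, ν k * cI k x := by
    refine hf.add ?_
    induction (Finset.univ : Finset {k // k ∉ J}) using Finset.induction_on with
    | empty => simpa using convexOn_const (0 : ℝ) convex_univ
    | insert k s hk ih =>
      simp only [Finset.sum_insert hk]
      exact ((hcI k).smul (hν k)).add ih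
  obtain ⟨μ, hμ, hμ'⟩ := hconv.exists_nonneg_forall_le_add_sum_of_affine a b p
    ⟨xbar, (hab xbar).2 ⟨hxE, hxJ⟩⟩ fun x hx => hν' x ((hab x).1 hx)
  refine ⟨fun i => μ (.inl i) - μ (.inr (.inl i)),
    fun i => if hi : i ∈ J then μ (.inr (.inr ⟨i, hi⟩)) else ν ⟨i, hi⟩, fun i => ?_, fun x => ?_⟩
  · dsimp only
    split_ifs
    exacts [hμ _, hν _]
  · have h₁ := hμ' x
    simp only [Fintype.sum_sum_type, a, b, Sum.elim_inl, Sum.elim_inr, LinearMap.neg_apply,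
      ← neg_add, ← hgE, ← hgJ, mul_neg, Finset.sum_neg_distrib] at h₁
    rw [← Fintype.sum_subtype_add_sum_subtype (· ∈ J)]
    have h₂ : ∀ j : {j // j ∈ J}, (if hi : (j : I) ∈ J then μ (.inr (.inr ⟨j, hi⟩))
        else ν ⟨j, hi⟩) = μ (.inr (.inr j)) := fun j => dif_pos j.2
    have h₃ : ∀ j : {j // j ∉ J}, (if hi : (j : I) ∈ J then μ (.inr (.inr ⟨j, hi⟩))
        else ν ⟨j, hi⟩) = ν j := fun j => dif_neg j.2
    simp only [h₂, h₃, sub_mul, Finset.sum_sub_distrib]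
    linarith

/-- Under convexity and Slater's condition, strong duality holds for the augmented
Lagrangian saddle-point problem for every `ρ > 0`. -/
theorem AL_strong_duality_convex {n : ℕ} {E I : Type*} [Fintype E] [Fintype I]
    (f : (Fin n → ℝ) → ℝ) (cE : E → (Fin n → ℝ) → ℝ) (cI : I → (Fin n → ℝ) → ℝ)
    (hfconv : ConvexOn ℝ Set.univ f)
    (hcIconv : ∀ i, ConvexOn ℝ Set.univ (cI i))
    (hcEaff : ∀ i, ∃ (g : (Fin n → ℝ) →ₗ[ℝ] ℝ) (b : ℝ), ∀ x, cE i x = g x + b)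
    (hslater : ∃ J : Set I,
      (∀ j ∈ J, ∃ (g : (Fin n → ℝ) →ₗ[ℝ] ℝ) (b : ℝ), ∀ x, cI j x = g x + b) ∧
      ∃ xbar : Fin n → ℝ,
        (∀ i, cE i xbar = 0) ∧ (∀ j ∈ J, cI j xbar ≤ 0) ∧ (∀ k ∉ J, cI k xbar < 0)) :
    ∀ ρ : ℝ, 0 < ρ →
      (⨆ (lam : E → ℝ) (μ : I → ℝ), ⨅ x : Fin n → ℝ, (AL f cE cI ρ x lam μ : EReal))
        = ⨅ x : Fin n → ℝ, ⨆ (lam : E → ℝ) (μ : I → ℝ), (AL f cE cI ρ x lam μ : EReal) := by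
  intro ρ hρ
  obtain ⟨J, hJ, xbar, hxE, hxJ, hxI⟩ := hslater
  refine le_antisymm ?_ ?_
  · exact iSup₂_le fun lam μ => le_iInf fun x => (iInf_le _ x).trans
      (le_iSup₂ (f := fun (lam : E → ℝ) (μ : I → ℝ) => (AL f cE cI ρ x lam μ : EReal)) lam μ)
  set R : EReal := ⨅ x : Fin n → ℝ, ⨆ (lam : E → ℝ) (μ : I → ℝ), (AL f cE cI ρ x lam μ : EReal)
    with hR
  have hRle : ∀ x, (∀ i, cE i x = 0) → (∀ i, cI i x ≤ 0) → R ≤ (f x : EReal) := fun x hE hI =>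
    (iInf_le _ x).trans <| iSup₂_le fun lam μ =>
      EReal.coe_le_coe_iff.2 (AL_le_of_feasible f cE cI hρ hE hI lam μ)
  refine EReal.ge_of_forall_gt_iff_ge.1 fun p hp => ?_
  obtain ⟨lam, μ, hμ, hle⟩ := exists_lagrange_multipliers_of_slater hfconv hcIconv hcEaff hJ
    hxE hxJ hxI (p := p) fun x hE hI => EReal.coe_le_coe_iff.1 (hp.le.trans (hRle x hE hI))
  refine le_trans (le_iInf fun x => ?_) (le_iSup₂
    (f := fun (lam : E → ℝ) (μ : I → ℝ) => ⨅ x, (AL f cE cI ρ x lam μ : EReal)) lam μ)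
  exact EReal.coe_le_coe_iff.2 ((hle x).trans (lagrangian_le_AL f cE cI hρ x lam hμ))
end

section
/- Suppose there exist a point x* ∈ X with A x* ∈ Q and x* ∈ K, and multipliers ν* ∈ X, λ* ∈ Y, μ* ∈ X satisfying the KKT conditions: ∇f(x*) + ν* + A*λ* + μ* = 0; ν* is a subgradient of h at x*, i.e. h(x*) is finite and h(y) ≥ h(x*) + ⟨ν*, y − x*⟩ for all y ∈ X; λ* lies in the normal cone of Q at A x*, i.e. ⟨λ*, y − A x*⟩ ≤ 0 for all y ∈ Q; and μ* lies in the normal cone of K at x*, i.e. ⟨μ*, y − x*⟩ ≤ 0 for all y ∈ K. Then for every ρ > 0 strong duality holds for the augmented Lagrangian: sup_{ν,μ∈X, λ∈Y} inf_{x∈X} 𝕃_ρ(x,ν,λ,μ) = inf_{x∈X} sup_{ν,μ∈X, λ∈Y} 𝕃_ρ(x,ν,λ,μ), and both sides equal f(x*) + h(x*), the optimal value of the composite problem. -/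
open scoped RealInnerProductSpace

/-- The Moreau envelope `e_ρ h (z) = inf_u ( h u + (ρ/2)‖u − z‖² )`, in the extended reals. -/
noncomputable def MoreauEnv {X : Type*} [NormedAddCommGroup X] [InnerProductSpace ℝ X]
    (h : X → EReal) (ρ : ℝ) (z : X) : EReal :=
  ⨅ u : X, (h u + (((ρ / 2) * ‖u - z‖ ^ 2 : ℝ) : EReal))

/-- The augmented Lagrangian of the composite problem
`min { f x + h x : A x ∈ Q, x ∈ K }`. -/
noncomputable def ALcomp {X Y : Type*} [NormedAddCommGroup X] [InnerProductSpace ℝ X]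
    [NormedAddCommGroup Y] [InnerProductSpace ℝ Y]
    (f : X → ℝ) (h : X → EReal) (A : X →L[ℝ] Y) (Q : Set Y) (K : Set X)
    (ρ : ℝ) (x ν : X) (lam : Y) (μ : X) : EReal :=
  ((f x : ℝ) : EReal) + MoreauEnv h ρ (x + ρ⁻¹ • ν)
    + (((ρ / 2) * (Metric.infDist (A x + ρ⁻¹ • lam) Q) ^ 2 : ℝ) : EReal)
    + (((ρ / 2) * (Metric.infDist (x + ρ⁻¹ • μ) K) ^ 2 : ℝ) : EReal)
    - (((1 / (2 * ρ)) * (‖ν‖ ^ 2 + ‖lam‖ ^ 2 + ‖μ‖ ^ 2) : ℝ) : EReal)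
theorem ConvexOn.add_inner_le_of_hasGradientAt {X : Type*}
    [NormedAddCommGroup X] [InnerProductSpace ℝ X] [CompleteSpace X]
    {f : X → ℝ} {g a : X} (hf : ConvexOn ℝ Set.univ f) (hg : HasGradientAt f g a) (x : X) :
    f a + ⟪g, x - a⟫ ≤ f x := by
  have hline : ConvexOn ℝ Set.univ (f ∘ AffineMap.lineMap (k := ℝ) a x) := by
    simpa using hf.comp_affineMap (AffineMap.lineMap (k := ℝ) a x)
  have hderiv : HasDerivAt (f ∘ AffineMap.lineMap (k := ℝ) a x) ⟪g, x - a⟫ 0 := by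
    have hg' : HasFDerivAt f (InnerProductSpace.toDual ℝ X g)
        (AffineMap.lineMap (k := ℝ) a x 0) := by
      simpa using hg.hasFDerivAt
    simpa using hg'.comp_hasDerivAt (0 : ℝ) AffineMap.hasDerivAt_lineMap
  have hslope := hline.le_slope_of_hasDerivAt (Set.mem_univ 0) (Set.mem_univ 1) one_pos hderiv
  simp [slope_def_field] at hslope
  linarith

/-- Completing the square: a shifted quadratic dominates its linearisation in `a - b`. -/
theorem inner_add_le_half_mul_norm_sub_add_smul_sq {E : Type*}
    [NormedAddCommGroup E] [InnerProductSpace ℝ E] {ρ : ℝ} (hρ : 0 < ρ) (a b v : E) :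
    ⟪v, a - b⟫ + 1 / (2 * ρ) * ‖v‖ ^ 2 ≤ ρ / 2 * ‖b - (a + ρ⁻¹ • v)‖ ^ 2 := by
  have hsplit : b - (a + ρ⁻¹ • v) = -((a - b) + ρ⁻¹ • v) := by abel
  have hsq : ρ / 2 * ‖b - (a + ρ⁻¹ • v)‖ ^ 2
      = ρ / 2 * ‖a - b‖ ^ 2 + ⟪v, a - b⟫ + 1 / (2 * ρ) * ‖v‖ ^ 2 := by
    rw [hsplit, norm_neg, norm_add_sq_real, inner_smul_right, norm_smul, mul_pow,
      Real.norm_eq_abs, sq_abs, real_inner_comm]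
    field_simp
  have hnonneg : 0 ≤ ρ / 2 * ‖a - b‖ ^ 2 := by positivity
  linarith

theorem half_mul_norm_inv_smul_sq {E : Type*} [NormedAddCommGroup E] [InnerProductSpace ℝ E]
    {ρ : ℝ} (hρ : 0 < ρ) (v : E) :
    ρ / 2 * ‖ρ⁻¹ • v‖ ^ 2 = 1 / (2 * ρ) * ‖v‖ ^ 2 := by
  rw [norm_smul, mul_pow, Real.norm_eq_abs, sq_abs]
  field_simp

theorem inner_add_le_half_mul_infDist_sq {E : Type*} [NormedAddCommGroup E]
    [InnerProductSpace ℝ E] [FiniteDimensional ℝ E] {S : Set E} (hS : IsClosed S)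
    {p v : E} (hp : p ∈ S) (hv : ∀ y ∈ S, ⟪v, y - p⟫ ≤ 0) {ρ : ℝ} (hρ : 0 < ρ) (a : E) :
    ⟪v, a - p⟫ + 1 / (2 * ρ) * ‖v‖ ^ 2
      ≤ ρ / 2 * Metric.infDist (a + ρ⁻¹ • v) S ^ 2 := by
  have : ProperSpace E := FiniteDimensional.proper ℝ E
  obtain ⟨q, hq, hdist⟩ := hS.exists_infDist_eq_dist ⟨p, hp⟩ (a + ρ⁻¹ • v)
  rw [hdist, dist_comm, dist_eq_norm]
  have hsplit : ⟪v, a - p⟫ = ⟪v, a - q⟫ + ⟪v, q - p⟫ := by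
    rw [← inner_add_right, sub_add_sub_cancel]
  linarith [hv q hq, inner_add_le_half_mul_norm_sub_add_smul_sq hρ a q v]

theorem half_mul_infDist_add_smul_sq_le {E : Type*} [NormedAddCommGroup E]
    [InnerProductSpace ℝ E] {S : Set E} {p : E} (hp : p ∈ S) {ρ : ℝ} (hρ : 0 < ρ) (v : E) :
    ρ / 2 * Metric.infDist (p + ρ⁻¹ • v) S ^ 2 ≤ 1 / (2 * ρ) * ‖v‖ ^ 2 := by
  have hle : Metric.infDist (p + ρ⁻¹ • v) S ≤ ‖ρ⁻¹ • v‖ := by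
    simpa [dist_eq_norm] using Metric.infDist_le_dist_of_mem (x := p + ρ⁻¹ • v) hp
  rw [← half_mul_norm_inv_smul_sq hρ]
  have := Metric.infDist_nonneg (x := p + ρ⁻¹ • v) (s := S)
  gcongr

theorem le_moreauEnv_of_subgradient {X : Type*} [NormedAddCommGroup X] [InnerProductSpace ℝ X]
    {h : X → EReal} {r : ℝ} {p v : X}
    (hv : ∀ y : X, (r : EReal) + ((⟪v, y - p⟫ : ℝ) : EReal) ≤ h y)
    {ρ : ℝ} (hρ : 0 < ρ) (x : X) :
    ((r + ⟪v, x - p⟫ + 1 / (2 * ρ) * ‖v‖ ^ 2 : ℝ) : EReal) ≤ MoreauEnv h ρ (x + ρ⁻¹ • v) := by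
  refine le_iInf fun u => le_trans ?_ (add_le_add_left (hv u) _)
  rw [← EReal.coe_add, ← EReal.coe_add, EReal.coe_le_coe_iff]
  have hsplit : ⟪v, x - p⟫ = ⟪v, x - u⟫ + ⟪v, u - p⟫ := by
    rw [← inner_add_right, sub_add_sub_cancel]
  linarith [inner_add_le_half_mul_norm_sub_add_smul_sq hρ x u v]

theorem moreauEnv_add_smul_le {X : Type*} [NormedAddCommGroup X] [InnerProductSpace ℝ X]
    {h : X → EReal} {r : ℝ} {p : X} (hr : h p = r) {ρ : ℝ} (hρ : 0 < ρ) (v : X) :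
    MoreauEnv h ρ (p + ρ⁻¹ • v) ≤ ((r + 1 / (2 * ρ) * ‖v‖ ^ 2 : ℝ) : EReal) := by
  refine (iInf_le _ p).trans (le_of_eq ?_)
  rw [hr, ← EReal.coe_add, sub_add_cancel_left, norm_neg, half_mul_norm_inv_smul_sq hρ]

/-- Existence of a KKT point implies strong duality for the augmented Lagrangian of the
convex composite problem, with the common value equal to the optimal value `f x* + h x*`. -/
theorem ALcomp_strong_duality_of_KKT {X Y : Type*}
    [NormedAddCommGroup X] [InnerProductSpace ℝ X] [FiniteDimensional ℝ X]
    [NormedAddCommGroup Y] [InnerProductSpace ℝ Y] [FiniteDimensional ℝ Y]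
    (A : X →L[ℝ] Y) (Q : Set Y) (K : Set X)
    (hQne : Q.Nonempty) (hQcl : IsClosed Q) (hQcv : Convex ℝ Q)
    (hKne : K.Nonempty) (hKcl : IsClosed K) (hKcv : Convex ℝ K)
    (f : X → ℝ) (f' : X → X)
    (hfconv : ConvexOn ℝ Set.univ f)
    (hfd : ∀ z : X, HasGradientAt f (f' z) z)
    (h : X → EReal)
    (hbot : ∀ x, h x ≠ ⊥) (hproper : ∃ x, h x ≠ ⊤)
    (hlsc : LowerSemicontinuous h)
    (hconv : ∀ x y : X, ∀ t : ℝ, 0 ≤ t → t ≤ 1 →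
      h (t • x + (1 - t) • y) ≤ (t : EReal) * h x + ((1 - t : ℝ) : EReal) * h y)
    (xstar νstar μstar : X) (lamstar : Y)
    (hfeasQ : A xstar ∈ Q) (hfeasK : xstar ∈ K)
    (hhfin : h xstar ≠ ⊤)
    (hKKT : f' xstar + νstar + (ContinuousLinearMap.adjoint A) lamstar + μstar = 0)
    (hsub : ∀ y : X, h xstar + ((⟪νstar, y - xstar⟫ : ℝ) : EReal) ≤ h y)
    (hnQ : ∀ y ∈ Q, ⟪lamstar, y - A xstar⟫ ≤ 0)
    (hnK : ∀ y ∈ K, ⟪μstar, y - xstar⟫ ≤ 0) :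
    ∀ ρ : ℝ, 0 < ρ →
      (⨆ (ν : X) (μ : X) (lam : Y), ⨅ x : X, ALcomp f h A Q K ρ x ν lam μ)
          = (⨅ x : X, ⨆ (ν : X) (μ : X) (lam : Y), ALcomp f h A Q K ρ x ν lam μ) ∧
      (⨅ x : X, ⨆ (ν : X) (μ : X) (lam : Y), ALcomp f h A Q K ρ x ν lam μ)
          = ((f xstar : ℝ) : EReal) + h xstar := by
  intro ρ hρ
  obtain ⟨r, hr⟩ : ∃ r : ℝ, h xstar = r :=
    ⟨(h xstar).toReal, (EReal.coe_toReal hhfin (hbot xstar)).symm⟩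
  rw [hr] at hsub ⊢
  have hlower : ∀ x, ((f xstar : ℝ) : EReal) + (r : EReal)
      ≤ ALcomp f h A Q K ρ x νstar lamstar μstar := by
    intro x
    have hstat : ⟪f' xstar, x - xstar⟫ + ⟪νstar, x - xstar⟫ + ⟪lamstar, A x - A xstar⟫
        + ⟪μstar, x - xstar⟫ = 0 := by
      rw [← map_sub, ← ContinuousLinearMap.adjoint_inner_left, ← inner_add_left,
        ← inner_add_left, ← inner_add_left, hKKT, inner_zero_left]
    have hf := hfconv.add_inner_le_of_hasGradientAt (hfd xstar) x
    have hQ := inner_add_le_half_mul_infDist_sq hQcl hfeasQ hnQ hρ (A x)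
    have hK := inner_add_le_half_mul_infDist_sq hKcl hfeasK hnK hρ x
    have hM := le_moreauEnv_of_subgradient hsub hρ x
    unfold ALcomp
    refine le_trans ?_ (EReal.sub_le_sub (add_le_add_left (add_le_add_left
      (add_le_add_right hM _) _) _) le_rfl)
    norm_cast
    linarith
  have hupper : ∀ ν μ lam, ALcomp f h A Q K ρ xstar ν lam μ
      ≤ ((f xstar : ℝ) : EReal) + (r : EReal) := by
    intro ν μ lam
    have hQ := half_mul_infDist_add_smul_sq_le hfeasQ hρ lam
    have hK := half_mul_infDist_add_smul_sq_le hfeasK hρ μ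
    have hM := moreauEnv_add_smul_le hr hρ ν
    unfold ALcomp
    refine le_trans (EReal.sub_le_sub (add_le_add_left (add_le_add_left
      (add_le_add_right hM _) _) _) le_rfl) ?_
    norm_cast
    linarith
  have hge : ((f xstar : ℝ) : EReal) + (r : EReal)
      ≤ ⨆ (ν : X) (μ : X) (lam : Y), ⨅ x : X, ALcomp f h A Q K ρ x ν lam μ :=
    le_iSup_of_le νstar (le_iSup_of_le μstar (le_iSup_of_le lamstar (le_iInf hlower)))
  have hle : (⨅ x : X, ⨆ (ν : X) (μ : X) (lam : Y), ALcomp f h A Q K ρ x ν lam μ)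
      ≤ ((f xstar : ℝ) : EReal) + (r : EReal) :=
    iInf_le_of_le xstar (iSup_le fun ν => iSup_le fun μ => iSup_le fun lam => hupper ν μ lam)
  have hweak : (⨆ (ν : X) (μ : X) (lam : Y), ⨅ x : X, ALcomp f h A Q K ρ x ν lam μ)
      ≤ ⨅ x : X, ⨆ (ν : X) (μ : X) (lam : Y), ALcomp f h A Q K ρ x ν lam μ :=
    le_iInf fun x => iSup_mono fun ν => iSup_mono fun μ => iSup_mono fun lam => iInf_le _ x
  exact ⟨le_antisymm hweak (hle.trans hge), le_antisymm hle (hge.trans hweak)⟩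
end

section
/- Let X be a real Hilbert space, let h : X → ℝ ∪ {+∞} be a proper lower semicontinuous convex function, let ρ > 0 and x ∈ X. Then the supremum over the multiplier of the Moreau-envelope term of the augmented Lagrangian recovers h: sup_{ν ∈ X} ( e_ρh(x + ν/ρ) − ‖ν‖²/(2ρ) ) = h(x), where the equation holds in the extended reals. -/
section AffineMinorant

variable {E : Type*} [AddCommGroup E] [Module ℝ E]

theorem convex_real_epigraph_of_ereal {h : E → EReal}
    (hconv : ∀ x y : E, ∀ t : ℝ, 0 ≤ t → t ≤ 1 →
      h (t • x + (1 - t) • y) ≤ (t : EReal) * h x + ((1 - t : ℝ) : EReal) * h y) :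
    Convex ℝ {p : E × ℝ | h p.1 ≤ (p.2 : EReal)} := by
  rintro ⟨x, r⟩ hx ⟨y, s⟩ hy a b ha hb hab
  obtain rfl : b = 1 - a := by linarith
  simp only [Set.mem_ofPred_eq] at hx hy
  have h1 := hconv x y a ha (by linarith)
  have h2 : (a : EReal) * h x ≤ (a : EReal) * (r : EReal) :=
    mul_le_mul_of_nonneg_left hx (EReal.coe_nonneg.2 ha)
  have h3 : ((1 - a : ℝ) : EReal) * h y ≤ ((1 - a : ℝ) : EReal) * (s : EReal) :=
    mul_le_mul_of_nonneg_left hy (EReal.coe_nonneg.2 hb)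
  refine (h1.trans (add_le_add h2 h3)).trans_eq ?_
  simp only [Prod.snd_add, Prod.smul_snd, smul_eq_mul, EReal.coe_add, EReal.coe_mul]

theorem LowerSemicontinuous.isClosed_real_epigraph_of_ereal {E : Type*} [TopologicalSpace E]
    {h : E → EReal} (hlsc : LowerSemicontinuous h) :
    IsClosed {p : E × ℝ | h p.1 ≤ (p.2 : EReal)} :=
  hlsc.isClosed_epigraph.preimage
    (continuous_fst.prodMk (continuous_coe_real_ereal.comp continuous_snd))

variable [TopologicalSpace E]

/-- A separating hyperplane which is not vertical is the graph of an affine minorant. -/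
theorem affine_le_of_separation_epigraph {h : E → EReal} (hbot : ∀ x, h x ≠ ⊥)
    {x : E} {a c u : ℝ} {φ : StrongDual ℝ E} (hc : 0 < c) (hx : φ x + c * a < u)
    (hsep : ∀ (y : E) (s : ℝ), h y ≤ (s : EReal) → u < φ y + c * s) (y : E) :
    ((a + (-c⁻¹ • φ) (y - x) : ℝ) : EReal) ≤ h y := by
  by_cases hy : h y = ⊤
  · simp [hy]
  have hs := hsep y
  lift h y to ℝ using ⟨hy, hbot y⟩ with r
  have h1 := hs r le_rfl
  rw [EReal.coe_le_coe_iff]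
  have h2 : c⁻¹ * (φ x - φ y + c * a) ≤ c⁻¹ * (c * r) :=
    mul_le_mul_of_nonneg_left (by linarith) (inv_nonneg.2 hc.le)
  rw [mul_add, inv_mul_cancel_left₀ hc.ne', inv_mul_cancel_left₀ hc.ne'] at h2
  simp only [smul_apply, map_sub, smul_eq_mul]
  linarith

variable [IsTopologicalAddGroup E] [ContinuousSMul ℝ E] [LocallyConvexSpace ℝ E]

/-- A point strictly below the graph of a proper lower semicontinuous convex function is strictly
separated from the epigraph by a closed hyperplane with nonnegative vertical coefficient. -/
theorem exists_separation_epigraph_of_lt {h : E → EReal}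
    (hbot : ∀ x, h x ≠ ⊥) (hproper : ∃ x, h x ≠ ⊤) (hlsc : LowerSemicontinuous h)
    (hconv : ∀ x y : E, ∀ t : ℝ, 0 ≤ t → t ≤ 1 →
      h (t • x + (1 - t) • y) ≤ (t : EReal) * h x + ((1 - t : ℝ) : EReal) * h y)
    {x : E} {a : ℝ} (hax : (a : EReal) < h x) :
    ∃ (φ : StrongDual ℝ E) (c u : ℝ), 0 ≤ c ∧ φ x + c * a < u ∧
      ∀ (y : E) (s : ℝ), h y ≤ (s : EReal) → u < φ y + c * s := by
  obtain ⟨f, u, hfx, hf⟩ := geometric_hahn_banach_point_closed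
    (convex_real_epigraph_of_ereal hconv) hlsc.isClosed_real_epigraph_of_ereal
    (x := (x, a)) (by simpa using hax)
  have hsplit (y : E) (s : ℝ) :
      f (y, s) = f.comp (ContinuousLinearMap.inl ℝ E ℝ) y + f (0, 1) * s := by
    have : ((y, s) : E × ℝ) = (y, 0) + s • ((0 : E), (1 : ℝ)) := by simp
    rw [this, map_add, map_smul, smul_eq_mul, mul_comm s]
    simp
  have hsep (y : E) (s : ℝ) (hy : h y ≤ (s : EReal)) :
      u < f.comp (ContinuousLinearMap.inl ℝ E ℝ) y + f (0, 1) * s := by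
    rw [← hsplit]
    exact hf (y, s) hy
  refine ⟨f.comp (ContinuousLinearMap.inl ℝ E ℝ), f (0, 1), u, ?_, hsplit x a ▸ hfx, hsep⟩
  obtain ⟨x₀, hx₀⟩ := hproper
  lift h x₀ to ℝ using ⟨hx₀, hbot x₀⟩ with r hr
  by_contra! hc
  generalize f (0, 1) = c at *
  set q := f.comp (ContinuousLinearMap.inl ℝ E ℝ) x₀
  have h1 := hsep x₀ (max r ((u - q) / c)) (by rw [← hr]; exact_mod_cast le_max_left _ _)
  have h2 : c * max r ((u - q) / c) ≤ c * ((u - q) / c) :=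
    mul_le_mul_of_nonpos_left (le_max_right _ _) hc.le
  rw [mul_div_cancel₀ _ hc.ne] at h2
  linarith

/-- A proper lower semicontinuous convex function with values in the extended reals has, below
every point not in its epigraph, a continuous affine minorant. -/
theorem exists_affine_le_of_lt_ereal {h : E → EReal}
    (hbot : ∀ x, h x ≠ ⊥) (hproper : ∃ x, h x ≠ ⊤) (hlsc : LowerSemicontinuous h)
    (hconv : ∀ x y : E, ∀ t : ℝ, 0 ≤ t → t ≤ 1 →
      h (t • x + (1 - t) • y) ≤ (t : EReal) * h x + ((1 - t : ℝ) : EReal) * h y)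
    {x : E} {a : ℝ} (hax : (a : EReal) < h x) :
    ∃ φ : StrongDual ℝ E, ∀ y, ((a + φ (y - x) : ℝ) : EReal) ≤ h y := by
  obtain ⟨φ, c, u, hc, hx, hsep⟩ :=
    exists_separation_epigraph_of_lt hbot hproper hlsc hconv hax
  obtain hc | rfl := hc.lt_or_eq
  · exact ⟨_, affine_le_of_separation_epigraph hbot hc hx hsep⟩
  obtain ⟨x₀, hx₀⟩ := id hproper
  obtain ⟨r, hr⟩ : ∃ r : ℝ, (r : EReal) = h x₀ := ⟨_, EReal.coe_toReal hx₀ (hbot x₀)⟩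
  have hlt : ((r - 1 : ℝ) : EReal) < h x₀ := by
    rw [← hr, EReal.coe_lt_coe_iff]; linarith
  obtain ⟨ψ, d, v, hd, hx₀v, hsep₀⟩ :=
    exists_separation_epigraph_of_lt hbot hproper hlsc hconv hlt
  have hd : 0 < d := by
    refine hd.lt_of_ne' fun h0 ↦ ?_
    have := hsep₀ x₀ r hr.ge
    subst h0
    linarith
  have hmin := affine_le_of_separation_epigraph hbot hd hx₀v hsep₀
  generalize -d⁻¹ • ψ = χ at hmin
  simp only [zero_mul, add_zero] at hx hsep
  set k : ℝ := max 0 ((a - (r - 1 + χ (x - x₀))) / (u - φ x))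
  have hk0 : 0 ≤ k := le_max_left _ _
  have hka : a - (r - 1 + χ (x - x₀)) ≤ k * (u - φ x) :=
    (div_le_iff₀ (by linarith)).1 (le_max_right _ _)
  refine ⟨χ - k • φ, fun y ↦ ?_⟩
  by_cases hy : h y = ⊤
  · simp [hy]
  refine le_trans ?_ (hmin y)
  have hu := hsep y (h y).toReal (EReal.coe_toReal hy (hbot y)).ge
  have hku : k * (u - φ y) ≤ 0 := mul_nonpos_of_nonneg_of_nonpos hk0 (by linarith)
  rw [EReal.coe_le_coe_iff]
  simp only [sub_apply, smul_apply, map_sub, smul_eq_mul] at hka ⊢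
  linarith

end AffineMinorant

theorem moreau_quadratic_sub_eq {X : Type*} [NormedAddCommGroup X] [InnerProductSpace ℝ X]
    {ρ : ℝ} (hρ : ρ ≠ 0) (x u ν : X) :
    ρ / 2 * ‖u - (x + ρ⁻¹ • ν)‖ ^ 2 - ‖ν‖ ^ 2 / (2 * ρ) =
      ρ / 2 * ‖u - x‖ ^ 2 - inner ℝ ν (u - x) := by
  rw [← sub_sub, norm_sub_sq_real, inner_smul_right, norm_smul, mul_pow, Real.norm_eq_abs, sq_abs,
    real_inner_comm]
  field_simp
  ring

/-- For a proper lower semicontinuous convex function `h` on a real Hilbert space,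
`sup_ν ( e_ρh(x + ν/ρ) − ‖ν‖²/(2ρ) ) = h x` in the extended reals. -/
theorem sup_moreau_term_eq {X : Type*} [NormedAddCommGroup X] [InnerProductSpace ℝ X]
    [CompleteSpace X]
    (h : X → EReal)
    (hbot : ∀ x, h x ≠ ⊥) (hproper : ∃ x, h x ≠ ⊤)
    (hlsc : LowerSemicontinuous h)
    (hconv : ∀ x y : X, ∀ t : ℝ, 0 ≤ t → t ≤ 1 →
      h (t • x + (1 - t) • y) ≤ (t : EReal) * h x + ((1 - t : ℝ) : EReal) * h y)
    (ρ : ℝ) (hρ : 0 < ρ) (x : X) :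
    (⨆ ν : X, (MoreauEnv h ρ (x + ρ⁻¹ • ν) - ((‖ν‖ ^ 2 / (2 * ρ) : ℝ) : EReal))) = h x := by
  refine le_antisymm (iSup_le fun ν ↦ ?_) (EReal.ge_of_forall_gt_iff_ge.1 fun a ha ↦ ?_)
  · have hx := moreau_quadratic_sub_eq hρ.ne' x x ν
    simp only [sub_self, norm_zero, inner_zero_right] at hx
    refine EReal.sub_le_of_le_add ((iInf_le _ x).trans_eq ?_)
    congr 2
    linarith
  · obtain ⟨φ, hφ⟩ := exists_affine_le_of_lt_ereal hbot hproper hlsc hconv ha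
    refine le_iSup_of_le ((InnerProductSpace.toDual ℝ X).symm φ) ?_
    rw [EReal.le_sub_iff_add_le (.inl (EReal.coe_ne_bot _)) (.inl (EReal.coe_ne_top _))]
    refine le_iInf fun u ↦ le_trans ?_ (add_le_add_left (hφ u) _)
    have hu := moreau_quadratic_sub_eq hρ.ne' x u ((InnerProductSpace.toDual ℝ X).symm φ)
    rw [InnerProductSpace.toDual_symm_apply] at hu
    have hsq : 0 ≤ ρ / 2 * ‖u - x‖ ^ 2 := by positivity
    norm_cast
    linarith
end

section
/- Assume: (i) the integer program is feasible and attains its optimal value f^IP at some point of K̄; (ii) there exists δ > 0 such that for every i ∈ {1,…,m} and every x ∈ K̄ with a_iᵀx > b_i one has (a_iᵀx − b_i)² ≥ δ; and (iii) the linear programming relaxation min { cᵀx : x ∈ ℝ^n, Bx ≤ d, Ax ≤ b } has a finite optimal value f^LP that admits an optimal dual vector for the constraints Ax ≤ b, i.e. there exists μ^LP ∈ ℝ^m with μ^LP ≥ 0 componentwise and cᵀx + (μ^LP)ᵀ(Ax − b) ≥ f^LP for all x ∈ ℝ^n with Bx ≤ d. Then there exists a finite penalty parameter ρ* ∈ (0,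 ∞) such that the augmented Lagrangian dual has zero duality gap: z_{ρ*}^{LD+} = f^IP. -/
open Matrix
open scoped BigOperators

/-- The pure integer linear set `K̄ = { x ∈ ℤ^n : B x ≤ d }`, viewed inside `ℝ^n`. -/
def Kbar {q n : ℕ} (B : Matrix (Fin q) (Fin n) ℝ) (d : Fin q → ℝ) : Set (Fin n → ℝ) :=
  {x | (∀ j, ∃ z : ℤ, x j = (z : ℝ)) ∧ B.mulVec x ≤ d}

/-- The augmented Lagrangian `L_ρ(x,μ) = cᵀx + μᵀ(Ax − b) + (ρ/2)‖(Ax − b)₊‖²` for the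
pure integer program `min { cᵀx : x ∈ K̄, A x ≤ b }`. -/
noncomputable def ALip {m n : ℕ} (c : Fin n → ℝ) (A : Matrix (Fin m) (Fin n) ℝ)
    (b : Fin m → ℝ) (ρ : ℝ) (x : Fin n → ℝ) (μ : Fin m → ℝ) : ℝ :=
  c ⬝ᵥ x + μ ⬝ᵥ (A.mulVec x - b) + (ρ / 2) * ∑ i, (max ((A.mulVec x - b) i) 0) ^ 2

/-- The augmented Lagrangian dual value `z_ρ^{LD+} = sup_{μ ≥ 0} inf_{x ∈ K̄} L_ρ(x,μ)`. -/
noncomputable def zLD {m q n : ℕ} (c : Fin n → ℝ) (A : Matrix (Fin m) (Fin n) ℝ)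
    (b : Fin m → ℝ) (B : Matrix (Fin q) (Fin n) ℝ) (d : Fin q → ℝ) (ρ : ℝ) : EReal :=
  ⨆ (μ : Fin m → ℝ) (_ : 0 ≤ μ), ⨅ (x : Fin n → ℝ) (_ : x ∈ Kbar B d),
    ((ALip c A b ρ x μ : ℝ) : EReal)

/-- Uniform separation of the violations `(y i)₊` from zero bounds a nonnegative linear
functional of `y` by the quadratic penalty. -/
lemma dotProduct_le_mul_sum_sq_posPart {ι : Type*} [Fintype ι] {δ : ℝ} (hδ : 0 < δ)
    {μ y : ι → ℝ} (hμ : 0 ≤ μ) (hy : ∀ i, 0 < y i → δ ≤ y i ^ 2) :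
    μ ⬝ᵥ y ≤ (∑ i, μ i) / √δ * ∑ i, max (y i) 0 ^ 2 := by
  have hr : 0 < √δ := Real.sqrt_pos.2 hδ
  rw [dotProduct, Finset.mul_sum]
  refine Finset.sum_le_sum fun i _ => ?_
  have hμi : μ i ≤ ∑ j, μ j := Finset.single_le_sum (fun j _ => hμ j) (Finset.mem_univ i)
  have hμ0 : 0 ≤ μ i := hμ i
  rcases le_or_gt (y i) 0 with h | h
  · rw [max_eq_right h]
    simpa using mul_nonpos_of_nonneg_of_nonpos hμ0 h
  · rw [max_eq_left h.le, div_mul_eq_mul_div, le_div_iff₀ hr]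
    have hry : √δ ≤ y i := Real.sqrt_le_left h.le |>.2 (hy i h)
    calc μ i * y i * √δ ≤ μ i * y i * y i := by gcongr
      _ = μ i * y i ^ 2 := by ring
      _ ≤ (∑ j, μ j) * y i ^ 2 := by gcongr

/-- A violated coordinate makes the quadratic penalty at least `δ`. -/
lemma le_sum_sq_posPart {ι : Type*} [Fintype ι] {δ : ℝ} {y : ι → ℝ}
    (hy : ∀ i, 0 < y i → δ ≤ y i ^ 2) {i : ι} (hi : 0 < y i) :
    δ ≤ ∑ i, max (y i) 0 ^ 2 :=
  calc δ ≤ max (y i) 0 ^ 2 := by rw [max_eq_left hi.le]; exact hy i hi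
    _ ≤ ∑ i, max (y i) 0 ^ 2 :=
      Finset.single_le_sum (f := fun i => max (y i) 0 ^ 2) (fun j _ => sq_nonneg _)
        (Finset.mem_univ i)

/-- At feasible points the augmented Lagrangian is at most the objective. -/
lemma ALip_le_of_feasible {m n : ℕ} (c : Fin n → ℝ) {A : Matrix (Fin m) (Fin n) ℝ}
    {b : Fin m → ℝ} (ρ : ℝ) {x : Fin n → ℝ} {μ : Fin m → ℝ} (hμ : 0 ≤ μ)
    (hx : A.mulVec x ≤ b) : ALip c A b ρ x μ ≤ c ⬝ᵥ x := by
  have hy : ∀ i, (A.mulVec x - b) i ≤ 0 := fun i => sub_nonpos.2 (hx i)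
  have h : μ ⬝ᵥ (A.mulVec x - b) ≤ 0 :=
    Finset.sum_nonpos fun i _ => mul_nonpos_of_nonneg_of_nonpos (hμ i) (hy i)
  have hs : ∑ i, max ((A.mulVec x - b) i) 0 ^ 2 = 0 :=
    Finset.sum_eq_zero fun i _ => by rw [max_eq_right (hy i)]; norm_num
  rw [ALip, hs]
  linarith

/-- Exact penalty / zero duality gap for the augmented Lagrangian dual of a pure integer
program: under feasibility with attainment, a uniform separation `δ` of the violated
constraints, and existence of an optimal LP dual vector, there is a finite `ρ* > 0`
such that `z_{ρ*}^{LD+} = f^{IP}`. -/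
theorem IP_strong_duality {m q n : ℕ}
    (c : Fin n → ℝ) (A : Matrix (Fin m) (Fin n) ℝ) (b : Fin m → ℝ)
    (B : Matrix (Fin q) (Fin n) ℝ) (d : Fin q → ℝ)
    (fIP : EReal)
    (hfIP : fIP = ⨅ (x : Fin n → ℝ) (_ : x ∈ Kbar B d ∧ A.mulVec x ≤ b), ((c ⬝ᵥ x : ℝ) : EReal))
    (hattain : ∃ x : Fin n → ℝ, x ∈ Kbar B d ∧ A.mulVec x ≤ b ∧ ((c ⬝ᵥ x : ℝ) : EReal) = fIP)
    (δ : ℝ) (hδ : 0 < δ)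
    (hsep : ∀ i : Fin m, ∀ x ∈ Kbar B d, b i < A.mulVec x i → δ ≤ (A.mulVec x i - b i) ^ 2)
    (fLP : ℝ) (μLP : Fin m → ℝ) (hμLP : 0 ≤ μLP)
    (hfLP : (fLP : EReal) = ⨅ (x : Fin n → ℝ) (_ : B.mulVec x ≤ d ∧ A.mulVec x ≤ b),
        ((c ⬝ᵥ x : ℝ) : EReal))
    (hdual : ∀ x : Fin n → ℝ, B.mulVec x ≤ d → fLP ≤ c ⬝ᵥ x + μLP ⬝ᵥ (A.mulVec x - b)) :
    ∃ ρstar : ℝ, 0 < ρstar ∧ zLD c A b B d ρstar = fIP := by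
  obtain ⟨xs, hxK, hxA, hxf⟩ := hattain
  set f : ℝ := c ⬝ᵥ xs
  have hmin : ∀ x ∈ Kbar B d, A.mulVec x ≤ b → f ≤ c ⬝ᵥ x := fun x hK hA => by
    rw [← EReal.coe_le_coe_iff, hxf, hfIP]
    exact iInf₂_le x ⟨hK, hA⟩
  have hgap : 0 ≤ f - fLP := by
    have h : μLP ⬝ᵥ (A.mulVec xs - b) ≤ 0 :=
      Finset.sum_nonpos fun i _ => mul_nonpos_of_nonneg_of_nonpos (hμLP i) (sub_nonpos.2 (hxA i))
    linarith [hdual xs hxK.2]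
  set M : ℝ := (∑ i, μLP i) / √δ
  have hM : 0 ≤ M := div_nonneg (Finset.sum_nonneg fun i _ => hμLP i) (Real.sqrt_nonneg δ)
  have hG : 0 ≤ (f - fLP) / δ := div_nonneg hgap hδ.le
  refine ⟨2 * (M + (f - fLP) / δ + 1), by positivity, ?_⟩
  rw [← hxf]
  refine le_antisymm (iSup₂_le fun μ hμ => (iInf₂_le xs hxK).trans
    (EReal.coe_le_coe_iff.2 (ALip_le_of_feasible c _ hμ hxA))) ?_
  -- The zero multiplier already closes the gap; `μLP` only enters through the size of `ρ`.
  refine le_iSup₂_of_le 0 le_rfl (le_iInf₂ fun x hx => EReal.coe_le_coe_iff.2 ?_)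
  have hy : ∀ i, 0 < (A.mulVec x - b) i → δ ≤ (A.mulVec x - b) i ^ 2 :=
    fun i hi => hsep i x hx (sub_pos.1 hi)
  rw [ALip, zero_dotProduct, add_zero, mul_div_cancel_left₀ _ (two_ne_zero' ℝ)]
  have hpen := dotProduct_le_mul_sum_sq_posPart hδ hμLP hy
  have hS : 0 ≤ ∑ i, max ((A.mulVec x - b) i) 0 ^ 2 := Finset.sum_nonneg fun i _ => sq_nonneg _
  by_cases hA : A.mulVec x ≤ b
  · have := hmin x hx hA
    have : 0 ≤ (M + (f - fLP) / δ + 1) * ∑ i, max ((A.mulVec x - b) i) 0 ^ 2 := by positivity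
    linarith
  · obtain ⟨i, hi⟩ : ∃ i, b i < A.mulVec x i := by simpa [Pi.le_def] using hA
    have hδS := le_sum_sq_posPart hy (sub_pos.2 hi)
    have hGS : f - fLP ≤ (f - fLP) / δ * ∑ i, max ((A.mulVec x - b) i) 0 ^ 2 :=
      calc f - fLP = (f - fLP) / δ * δ := (div_mul_cancel₀ _ hδ.ne').symm
        _ ≤ _ := by gcongr
    linarith [hdual x hx.2]
end

section
/- For every fixed x ∈ ℝ^n, the map (λ, μ, ρ) ↦ 𝕃_ρ(x,λ,μ) is concave on the convex set ℝ^E × ℝ^I × (0, ∞). Consequently, the augmented dual function Φ(λ,μ,ρ) = inf_{x∈ℝ^n} 𝕃_ρ(x,λ,μ), taking values in ℝ ∪ {−∞}, is concave on ℝ^E × ℝ^I × (0, ∞): for all points w₁ = (λ₁,μ₁,ρ₁) and w₂ = (λ₂,μ₂,ρ₂) with ρ₁, ρ₂ > 0 and all t ∈ [0,1], Φ(t w₁ + (1−t) w₂) ≥ t Φ(w₁) + (1−t) Φ(w₂) in the extended reals. -/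
open scoped BigOperators

/-- The inequality term of the augmented Lagrangian is bounded above by the function
`μ s + (ρ / 2) s²`, linear in `(μ, ρ)`, for every `s ≥ c`. -/
lemma AL_term_le {ρ : ℝ} (hρ : 0 < ρ) (μ : ℝ) {c s : ℝ} (hs : c ≤ s) :
    (ρ / 2) * ((max (μ / ρ + c) 0) ^ 2 - μ ^ 2 / ρ ^ 2) ≤ μ * s + (ρ / 2) * s ^ 2 := by
  have hsq : (max (μ / ρ + c) 0) ^ 2 ≤ (μ / ρ + s) ^ 2 := by
    rcases le_total (μ / ρ + c) 0 with h | h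
    · rw [max_eq_right h]
      nlinarith [sq_nonneg (μ / ρ + s)]
    · rw [max_eq_left h]
      gcongr
  calc (ρ / 2) * ((max (μ / ρ + c) 0) ^ 2 - μ ^ 2 / ρ ^ 2)
      ≤ (ρ / 2) * ((μ / ρ + s) ^ 2 - μ ^ 2 / ρ ^ 2) := by gcongr
    _ = μ * s + (ρ / 2) * s ^ 2 := by field_simp; ring

/-- The bound of `AL_term_le` is attained at some `s ≥ c`. -/
lemma exists_AL_term_eq {ρ : ℝ} (hρ : 0 < ρ) (μ c : ℝ) :
    ∃ s, c ≤ s ∧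
      (ρ / 2) * ((max (μ / ρ + c) 0) ^ 2 - μ ^ 2 / ρ ^ 2) = μ * s + (ρ / 2) * s ^ 2 := by
  rcases le_total (μ / ρ + c) 0 with h | h
  · refine ⟨-(μ / ρ), by linarith, ?_⟩
    rw [max_eq_right h]
    field_simp
    ring
  · refine ⟨c, le_rfl, ?_⟩
    rw [max_eq_left h]
    field_simp
    ring

/-- The inequality term of the augmented Lagrangian is jointly concave in `(μ, ρ)`. -/
lemma AL_term_concave {ρ₁ ρ₂ a b : ℝ} (h₁ : 0 < ρ₁) (h₂ : 0 < ρ₂) (ha : 0 ≤ a) (hb : 0 ≤ b)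
    (hρ : 0 < a * ρ₁ + b * ρ₂) (μ₁ μ₂ c : ℝ) :
    a * ((ρ₁ / 2) * ((max (μ₁ / ρ₁ + c) 0) ^ 2 - μ₁ ^ 2 / ρ₁ ^ 2))
      + b * ((ρ₂ / 2) * ((max (μ₂ / ρ₂ + c) 0) ^ 2 - μ₂ ^ 2 / ρ₂ ^ 2))
      ≤ ((a * ρ₁ + b * ρ₂) / 2) * ((max ((a * μ₁ + b * μ₂) / (a * ρ₁ + b * ρ₂) + c) 0) ^ 2
          - (a * μ₁ + b * μ₂) ^ 2 / (a * ρ₁ + b * ρ₂) ^ 2) := by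
  obtain ⟨s, hs, heq⟩ := exists_AL_term_eq hρ (a * μ₁ + b * μ₂) c
  rw [heq]
  have e₁ := mul_le_mul_of_nonneg_left (AL_term_le h₁ μ₁ hs) ha
  have e₂ := mul_le_mul_of_nonneg_left (AL_term_le h₂ μ₂ hs) hb
  linarith

/-- For fixed `x`, the augmented Lagrangian is concave in `(λ, μ, ρ)` on `ρ > 0`. -/
lemma AL_concaveOn {n : ℕ} {E I : Type*} [Fintype E] [Fintype I]
    (f : (Fin n → ℝ) → ℝ) (cE : E → (Fin n → ℝ) → ℝ) (cI : I → (Fin n → ℝ) → ℝ)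
    (x : Fin n → ℝ) :
    ConcaveOn ℝ {p : (E → ℝ) × (I → ℝ) × ℝ | 0 < p.2.2}
      (fun p => AL f cE cI p.2.2 x p.1 p.2.1) := by
  have hconv : Convex ℝ {p : (E → ℝ) × (I → ℝ) × ℝ | 0 < p.2.2} :=
    (convex_Ioi (0 : ℝ)).linear_preimage
      (LinearMap.snd ℝ (I → ℝ) ℝ ∘ₗ LinearMap.snd ℝ (E → ℝ) ((I → ℝ) × ℝ))
  refine ⟨hconv, ?_⟩
  rintro ⟨l₁, μ₁, ρ₁⟩ h₁ ⟨l₂, μ₂, ρ₂⟩ h₂ a b ha hb hab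
  have hρ : 0 < a * ρ₁ + b * ρ₂ := hconv h₁ h₂ ha hb hab
  have hI := Finset.sum_le_sum fun i (_ : i ∈ Finset.univ) =>
    AL_term_concave h₁ h₂ ha hb hρ (μ₁ i) (μ₂ i) (cI i x)
  simp only [Finset.sum_add_distrib, ← Finset.mul_sum] at hI
  have hE : ∑ i, (a * l₁ i + b * l₂ i) * cE i x
      = a * ∑ i, l₁ i * cE i x + b * ∑ i, l₂ i * cE i x := by
    simp only [Finset.mul_sum, ← Finset.sum_add_distrib]
    exact Finset.sum_congr rfl fun i _ => by ring
  have hf : f x = a * f x + b * f x := by rw [← add_mul, hab, one_mul]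
  simp only [AL, Prod.smul_mk, Prod.mk_add_mk, Pi.add_apply, Pi.smul_apply, smul_eq_mul, hE]
  linarith

/-- For fixed `x`, the map `(λ, μ, ρ) ↦ 𝕃_ρ(x,λ,μ)` is concave on
`ℝ^E × ℝ^I × (0,∞)`, and consequently the augmented dual function
`Φ(λ,μ,ρ) = inf_x 𝕃_ρ(x,λ,μ)` is concave there, in the extended reals. -/
theorem AL_concave_in_dual_variables {n : ℕ} {E I : Type*} [Fintype E] [Fintype I]
    (f : (Fin n → ℝ) → ℝ) (cE : E → (Fin n → ℝ) → ℝ) (cI : I → (Fin n → ℝ) → ℝ) :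
    (∀ x : Fin n → ℝ,
      ConcaveOn ℝ {p : (E → ℝ) × (I → ℝ) × ℝ | 0 < p.2.2}
        (fun p => AL f cE cI p.2.2 x p.1 p.2.1)) ∧
    (∀ w₁ w₂ : (E → ℝ) × (I → ℝ) × ℝ, 0 < w₁.2.2 → 0 < w₂.2.2 →
      ∀ t : ℝ, 0 ≤ t → t ≤ 1 →
        (t : EReal) * (⨅ x : Fin n → ℝ, (AL f cE cI w₁.2.2 x w₁.1 w₁.2.1 : EReal))
            + ((1 - t : ℝ) : EReal) * (⨅ x : Fin n → ℝ, (AL f cE cI w₂.2.2 x w₂.1 w₂.2.1 : EReal))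
          ≤ ⨅ x : Fin n → ℝ,
              (AL f cE cI (t • w₁ + (1 - t) • w₂).2.2 x (t • w₁ + (1 - t) • w₂).1
                (t • w₁ + (1 - t) • w₂).2.1 : EReal)) := by
  refine ⟨AL_concaveOn f cE cI, fun w₁ w₂ h₁ h₂ t ht₀ ht₁ => le_iInf fun x => ?_⟩
  have ht₁' : 0 ≤ 1 - t := sub_nonneg.mpr ht₁
  have hx := (AL_concaveOn f cE cI x).2 h₁ h₂ ht₀ ht₁' (add_sub_cancel t 1)
  simp only [smul_eq_mul] at hx
  refine (add_le_add
    (mul_le_mul_of_nonneg_left (iInf_le _ x) (EReal.coe_nonneg.mpr ht₀))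
    (mul_le_mul_of_nonneg_left (iInf_le _ x) (EReal.coe_nonneg.mpr ht₁'))).trans ?_
  exact_mod_cast hx
end

section
/- For every fixed x ∈ ℝ^n, the function (λ, μ, ρ) ↦ 𝕃_ρ(x,λ,μ) is continuously differentiable on ℝ^E × ℝ^I × (0, ∞), with partial derivatives ∂𝕃/∂λ_i = c_i(x) for each i ∈ E, ∂𝕃/∂μ_i = max(−μ_i/ρ, c_i(x)) for each i ∈ I, and ∂𝕃/∂ρ = (1/2) Σ_{i∈E} c_i(x)² + (1/2) Σ_{i∈I} max(−μ_i/ρ, c_i(x))². -/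
open scoped BigOperators

/-- The squared positive part `t ↦ max t 0 ^ 2` has derivative `2 * max t 0`. -/
theorem hasDerivAt_max_zero_sq (t : ℝ) :
    HasDerivAt (fun s : ℝ => max s 0 ^ 2) (2 * max t 0) t := by
  have off_zero : ∀ y : ℝ, y ≠ 0 → HasDerivAt (fun s : ℝ => max s 0 ^ 2) (2 * max y 0) y := by
    intro y hy
    rcases lt_or_gt_of_ne hy with h | h
    · rw [max_eq_right h.le, mul_zero]
      refine (hasDerivAt_const y (0 : ℝ)).congr_of_eventuallyEq ?_
      filter_upwards [Iio_mem_nhds h] with s hs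
      simp [max_eq_right (Set.mem_Iio.mp hs).le]
    · rw [max_eq_left h.le]
      have hpow : HasDerivAt (fun s : ℝ => s ^ 2) (2 * y) y := by
        simpa using hasDerivAt_pow 2 y
      refine hpow.congr_of_eventuallyEq ?_
      filter_upwards [Ioi_mem_nhds h] with s hs
      simp [max_eq_left (Set.mem_Ioi.mp hs).le]
  rcases eq_or_ne t 0 with rfl | ht
  · exact hasDerivAt_of_hasDerivAt_of_ne off_zero
      (Continuous.continuousAt (by fun_prop)) (Continuous.continuousAt (by fun_prop))
  · exact off_zero t ht

/-- The squared positive part is continuously differentiable. -/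
theorem contDiff_max_zero_sq : ContDiff ℝ 1 (fun s : ℝ => max s 0 ^ 2) := by
  rw [contDiff_one_iff_deriv]
  refine ⟨fun t => (hasDerivAt_max_zero_sq t).differentiableAt, ?_⟩
  rw [funext fun t => (hasDerivAt_max_zero_sq t).deriv]
  fun_prop

/-- The shifted positive part minus the shift is the maximum in the multiplier derivative. -/
theorem max_add_zero_sub (m c r : ℝ) :
    max (m / r + c) 0 - m / r = max (-m / r) c := by
  rw [← max_sub_sub_right, max_comm]
  congr 1 <;> ring

/-- Derivative of an inequality term of the augmented Lagrangian in its multiplier. -/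
theorem hasDerivAt_ineq_term_multiplier (c m : ℝ) {r : ℝ} (hr : r ≠ 0) :
    HasDerivAt (fun t : ℝ => r / 2 * (max (t / r + c) 0 ^ 2 - t ^ 2 / r ^ 2))
      (max (-m / r) c) m := by
  have inner : HasDerivAt (fun t : ℝ => t / r + c) (1 / r) m :=
    ((hasDerivAt_id m).div_const r).add_const c
  have square := (hasDerivAt_pow 2 m).div_const (r ^ 2)
  refine ((((hasDerivAt_max_zero_sq (m / r + c)).comp m inner).sub square).const_mul
    (r / 2)).congr_deriv ?_
  rw [← max_add_zero_sub]
  field_simp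
  norm_num
  ring

/-- Derivative of an inequality term of the augmented Lagrangian in the penalty parameter. -/
theorem hasDerivAt_ineq_term_penalty (c m : ℝ) {r : ℝ} (hr : r ≠ 0) :
    HasDerivAt (fun t : ℝ => t / 2 * (max (m / t + c) 0 ^ 2 - m ^ 2 / t ^ 2))
      (1 / 2 * max (-m / r) c ^ 2) r := by
  have inner : HasDerivAt (fun t : ℝ => m / t + c) ((0 * r - m * 1) / r ^ 2) r :=
    ((hasDerivAt_const r m).div (hasDerivAt_id r) hr).add_const c
  have square := (hasDerivAt_const r (m ^ 2)).div (hasDerivAt_pow 2 r) (pow_ne_zero 2 hr)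
  refine (((hasDerivAt_id r).div_const 2).mul
    (((hasDerivAt_max_zero_sq (m / r + c)).comp r inner).sub square)).congr_deriv ?_
  rw [← max_add_zero_sub]
  simp only [Function.comp_apply, Pi.sub_apply, Pi.div_apply, id]
  field_simp
  norm_num
  ring

/-- If `g i` has derivative `d` at `v i`, then so does `∑ j, g j (v j)` as a function of the
`i`-th coordinate of `v`. -/
theorem hasDerivAt_sum_update {ι : Type*} [Fintype ι] [DecidableEq ι] (g : ι → ℝ → ℝ)
    (v : ι → ℝ) (i : ι) {d : ℝ} (hg : HasDerivAt (g i) d (v i)) :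
    HasDerivAt (fun t : ℝ => ∑ j, g j (Function.update v i t j)) d (v i) := by
  have split : (fun t : ℝ => ∑ j, g j (Function.update v i t j)) =
      fun t => g i t + ∑ j ∈ Finset.univ.erase i, g j (v j) := by
    funext t
    rw [← Finset.add_sum_erase _ _ (Finset.mem_univ i), Function.update_self]
    congr 1
    refine Finset.sum_congr rfl fun j hj => ?_
    rw [Function.update_of_ne (Finset.ne_of_mem_erase hj)]
  rw [split]
  exact hg.add_const _

/-- For fixed `x`, the map `(λ, μ, ρ) ↦ 𝕃_ρ(x,λ,μ)` is continuously differentiable on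
`ℝ^E × ℝ^I × (0,∞)`, with partial derivatives `∂𝕃/∂λ_i = c_i(x)` (i ∈ E),
`∂𝕃/∂μ_i = max(−μ_i/ρ, c_i(x))` (i ∈ I), and
`∂𝕃/∂ρ = (1/2) Σ_E c_i(x)² + (1/2) Σ_I max(−μ_i/ρ, c_i(x))²`. -/
theorem AL_dual_derivatives {n : ℕ} {E I : Type*} [Fintype E] [Fintype I]
    [DecidableEq E] [DecidableEq I]
    (f : (Fin n → ℝ) → ℝ) (cE : E → (Fin n → ℝ) → ℝ) (cI : I → (Fin n → ℝ) → ℝ)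
    (x : Fin n → ℝ) :
    ContDiffOn ℝ 1 (fun p : (E → ℝ) × (I → ℝ) × ℝ => AL f cE cI p.2.2 x p.1 p.2.1)
      {p : (E → ℝ) × (I → ℝ) × ℝ | 0 < p.2.2} ∧
    (∀ (lam : E → ℝ) (μ : I → ℝ) (ρ : ℝ), 0 < ρ →
      (∀ i : E, HasDerivAt (fun t : ℝ => AL f cE cI ρ x (Function.update lam i t) μ)
        (cE i x) (lam i)) ∧
      (∀ i : I, HasDerivAt (fun t : ℝ => AL f cE cI ρ x lam (Function.update μ i t))
        (max (-(μ i) / ρ) (cI i x)) (μ i)) ∧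
      HasDerivAt (fun r : ℝ => AL f cE cI r x lam μ)
        ((1 / 2) * ∑ i, (cE i x) ^ 2 + (1 / 2) * ∑ i, (max (-(μ i) / ρ) (cI i x)) ^ 2) ρ) := by
  refine ⟨?_, fun lam μ ρ hρ => ⟨fun i => ?_, fun i => ?_, ?_⟩⟩
  · unfold AL
    have hρ : ∀ p ∈ {p : (E → ℝ) × (I → ℝ) × ℝ | 0 < p.2.2}, p.2.2 ≠ 0 := fun p hp => ne_of_gt hp
    have hmax : ∀ i, ContDiffOn ℝ 1
        (fun p : (E → ℝ) × (I → ℝ) × ℝ => max (p.2.1 i / p.2.2 + cI i x) 0 ^ 2)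
        {p | 0 < p.2.2} := fun i =>
      contDiff_max_zero_sq.comp_contDiffOn
        ((ContDiffOn.div (by fun_prop) (by fun_prop) hρ).add contDiffOn_const)
    have hsq : ∀ i, ContDiffOn ℝ 1
        (fun p : (E → ℝ) × (I → ℝ) × ℝ => p.2.1 i ^ 2 / p.2.2 ^ 2) {p | 0 < p.2.2} := fun i =>
      ContDiffOn.div (by fun_prop) (by fun_prop) fun p hp => pow_ne_zero 2 (hρ p hp)
    refine ContDiffOn.add (by fun_prop) (ContDiffOn.mul (by fun_prop) ?_)
    exact ContDiffOn.sum fun i _ => (hmax i).sub (hsq i)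
  · unfold AL
    exact (((hasDerivAt_sum_update (fun j t => t * cE j x) lam i
      (hasDerivAt_mul_const (cE i x))).const_add (f x)).add_const _).add_const _
  · simp only [AL, Finset.mul_sum]
    exact (hasDerivAt_sum_update
      (fun j t => ρ / 2 * (max (t / ρ + cI j x) 0 ^ 2 - t ^ 2 / ρ ^ 2)) μ i
      (hasDerivAt_ineq_term_multiplier (cI i x) (μ i) hρ.ne')).const_add _
  · have heq : HasDerivAt (fun r : ℝ => r / 2 * ∑ i, cE i x ^ 2)
        (1 / 2 * ∑ i, cE i x ^ 2) ρ :=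
      ((hasDerivAt_id ρ).div_const 2).mul_const _
    have hineq : HasDerivAt
        (fun r : ℝ => r / 2 * ∑ i, (max (μ i / r + cI i x) 0 ^ 2 - μ i ^ 2 / r ^ 2))
        (1 / 2 * ∑ i, max (-(μ i) / ρ) (cI i x) ^ 2) ρ := by
      simp only [Finset.mul_sum]
      exact HasDerivAt.fun_sum fun i _ => hasDerivAt_ineq_term_penalty (cI i x) (μ i) hρ.ne'
    exact (heq.const_add _).add hineq
end

section
/- Let κ > 1, let 0 < α ≤ β ≤ 1, let ρ₀ > 1, and set ε₀ = ρ₀^{−α}. Let (ρ_k) ⊂ (0,∞), (ε_k) ⊂ (0,∞) and (Λ^k) in a normed space be sequences generated according to the penalty and tolerance updates of the practical augmented Lagrangian method: for every k, either (successful step) ρ_{k+1} = ρ_k, ε_{k+1} = ε_k / ρ_{k+1}^β and ‖Λ^{k+1}‖ ≤ ‖Λ^k‖ + ρ_k ε_k, or (penalty increase) ρ_{k+1} = κ ρ_k, ε_{k+1} = ρ_{k+1}^{−α} and Λ^{k+1} = Λ^k. If ρ_k → ∞ as k → ∞, then Λ^k / ρ_k → 0. -/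
open Filter

/-- A sequence with nonnegative initial term that grows by at most a multiple of `ρ (k + 1) ^ s`,
and only when `ρ` is multiplied by `κ > 1`, is bounded by a multiple of `ρ k ^ s`. -/
theorem exists_le_mul_rpow_of_geometric_step {κ s C : ℝ} (hκ : 1 < κ) (hs : 0 < s) (hC : 0 ≤ C)
    {ρ M : ℕ → ℝ} (hρ : ∀ k, 1 ≤ ρ k) (hM0 : 0 ≤ M 0)
    (hstep : ∀ k, (ρ (k + 1) = ρ k ∧ M (k + 1) ≤ M k) ∨
      (ρ (k + 1) = κ * ρ k ∧ M (k + 1) ≤ M k + C * ρ (k + 1) ^ s)) :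
    ∃ A, ∀ k, M k ≤ A * ρ k ^ s := by
  have hκs : 0 < κ ^ s - 1 := sub_pos.2 (Real.one_lt_rpow hκ hs)
  have hκ0 : 0 < κ := by linarith
  set D := C * κ ^ s / (κ ^ s - 1)
  have hD0 : 0 ≤ D := by positivity
  have hDmul : D * (κ ^ s - 1) = C * κ ^ s := div_mul_cancel₀ _ hκs.ne'
  refine ⟨M 0 + D, fun k => ?_⟩
  induction k with
  | zero =>
    have h1 : 1 ≤ ρ 0 ^ s := Real.one_le_rpow (hρ 0) hs.le
    nlinarith
  | succ k ih =>
    rcases hstep k with ⟨hr, hM⟩ | ⟨hr, hM⟩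
    · rw [hr]
      exact hM.trans ih
    · have hρ0 : 0 ≤ ρ k := zero_le_one.trans (hρ k)
      rw [hr, Real.mul_rpow hκ0.le hρ0] at hM
      rw [hr, Real.mul_rpow hκ0.le hρ0]
      have h2 : 0 ≤ M 0 * ((κ ^ s - 1) * ρ k ^ s) := by positivity
      calc M (k + 1) ≤ (M 0 + D) * ρ k ^ s + C * κ ^ s * ρ k ^ s := by linarith
        _ = (M 0 + D) * ρ k ^ s + D * (κ ^ s - 1) * ρ k ^ s := by rw [hDmul]
        _ ≤ (M 0 + D) * (κ ^ s * ρ k ^ s) := by linarith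

/-- In the practical augmented Lagrangian method, if the penalty parameters diverge then
the rescaled multipliers `Λ^k / ρ_k` tend to zero. -/
theorem multipliers_over_penalty_tendsto_zero {V : Type*}
    [NormedAddCommGroup V] [NormedSpace ℝ V]
    (κ α β : ℝ) (hκ : 1 < κ) (hα : 0 < α) (hαβ : α ≤ β) (hβ : β ≤ 1)
    (ρ : ℕ → ℝ) (ε : ℕ → ℝ) (Λ : ℕ → V)
    (hρpos : ∀ k, 0 < ρ k) (hεpos : ∀ k, 0 < ε k)
    (hρ0 : 1 < ρ 0) (hε0 : ε 0 = ρ 0 ^ (-α))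
    (hstep : ∀ k,
      (ρ (k + 1) = ρ k ∧ ε (k + 1) = ε k / ρ (k + 1) ^ β ∧
        ‖Λ (k + 1)‖ ≤ ‖Λ k‖ + ρ k * ε k) ∨
      (ρ (k + 1) = κ * ρ k ∧ ε (k + 1) = ρ (k + 1) ^ (-α) ∧ Λ (k + 1) = Λ k))
    (hρtop : Tendsto ρ atTop atTop) :
    Tendsto (fun k => (ρ k)⁻¹ • Λ k) atTop (nhds 0) := by
  have hρge : ∀ k, ρ 0 ≤ ρ k := by
    intro k
    induction k with
    | zero => rfl
    | succ k ih =>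
      rcases hstep k with ⟨hr, -⟩ | ⟨hr, -⟩
      · rwa [hr]
      · rw [hr]
        nlinarith [hρpos k]
  have hβ0 : 0 < β := hα.trans_le hαβ
  set q := (ρ 0 ^ β)⁻¹ with hq
  have hq1 : 0 < 1 - q := sub_pos.2 (inv_lt_one_of_one_lt₀ (Real.one_lt_rpow hρ0 hβ0))
  set C := (1 - q)⁻¹
  have hC0 : 0 < C := inv_pos.2 hq1
  have hCq : 1 + q * C = C := by
    have : (1 - q) * C = 1 := mul_inv_cancel₀ hq1.ne'
    linarith
  -- The potential `‖Λ k‖ + C * (ρ k * ε k)` does not increase in successful steps.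
  obtain ⟨A, hA⟩ := exists_le_mul_rpow_of_geometric_step (s := 1 - α / 2) (C := C)
    (M := fun k => ‖Λ k‖ + C * (ρ k * ε k)) hκ (by linarith) hC0.le
    (fun k => hρ0.le.trans (hρge k))
    (by have := hρpos 0; have := hεpos 0; positivity)
    (by
      intro k
      rcases hstep k with ⟨hr, he, hΛ⟩ | ⟨hr, he, hΛ⟩
      · refine Or.inl ⟨hr, ?_⟩
        have hle : ε (k + 1) ≤ ε k * q := by
          rw [he, div_eq_mul_inv, hq]
          have := hρpos 0
          have := hεpos k
          gcongr
          exact hρge (k + 1)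
        calc ‖Λ (k + 1)‖ + C * (ρ (k + 1) * ε (k + 1))
            ≤ (‖Λ k‖ + ρ k * ε k) + C * (ρ k * (ε k * q)) := by
              rw [hr]
              have := hρpos k
              gcongr
          _ = ‖Λ k‖ + (1 + q * C) * (ρ k * ε k) := by ring
          _ = ‖Λ k‖ + C * (ρ k * ε k) := by rw [hCq]
      · refine Or.inr ⟨hr, ?_⟩
        have hle : ρ (k + 1) * ε (k + 1) ≤ ρ (k + 1) ^ (1 - α / 2) := by
          nth_rewrite 1 [he, ← Real.rpow_one (ρ (k + 1))]
          rw [← Real.rpow_add (hρpos _)]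
          exact Real.rpow_le_rpow_of_exponent_le (hρ0.le.trans (hρge _)) (by linarith)
        have h0 : 0 ≤ C * (ρ k * ε k) := by
          have := hρpos k
          have := hεpos k
          positivity
        have := mul_le_mul_of_nonneg_left hle hC0.le
        rw [hΛ]
        linarith)
  have hlim : Tendsto (fun k => A * ρ k ^ (-(α / 2))) atTop (nhds 0) := by
    simpa using ((tendsto_rpow_neg_atTop (half_pos hα)).comp hρtop).const_mul A
  refine squeeze_zero_norm (fun k => ?_) hlim
  have hk := hρpos k
  have hΛ : ‖Λ k‖ ≤ A * ρ k ^ (1 - α / 2) := by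
    have := hεpos k
    exact (le_add_of_nonneg_right (by positivity)).trans (hA k)
  rw [norm_smul, norm_inv, Real.norm_of_nonneg hk.le, inv_mul_le_iff₀ hk]
  refine hΛ.trans_eq ?_
  rw [sub_eq_add_neg, Real.rpow_add hk, Real.rpow_one]
  ring
end
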